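/- arXiv:1707.09164 — 2 statements merged into one kernel-verified Lean document; each statement's English description precedes it below -/
import Mathlib

section
/- Let B be a Bol superalgebra over a field K of characteristic 0. If P is a pseudo superderivation of B of degree r with companion a and R is a pseudo superderivation of B of degree s with companion c, then the supercommutator [P,R] := P∘R − (−1)^{rs} R∘P is a pseudo superderivation of B of degree r+s with companion P(c) − (−1)^{rs} R(a) − a·c. -/
open LinearMap

/-- The sign `(-1)^(i·j)` in the ground field, for parities `i j : ZMod 2`. -/
def sgn (K : Type*) [Field K] (i j : ZMod 2) : K := (-1 : K) ^ (i * j).val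

/-- A Bol superalgebra over `K`: a `ZMod 2`-graded vector space with a bilinear
product `mul` and a trilinear bracket `tri` satisfying (BS1)–(BS5) on
homogeneous elements. -/
structure BolSuper (K : Type*) (B : Type*) [Field K] [AddCommGroup B] [Module K B] where
  g : ZMod 2 → Submodule K B
  internal : DirectSum.IsInternal g
  mul : B →ₗ[K] B →ₗ[K] B
  tri : B →ₗ[K] B →ₗ[K] B →ₗ[K] B
  mul_mem : ∀ i j x y, x ∈ g i → y ∈ g j → mul x y ∈ g (i + j)
  tri_mem : ∀ i j k x y z, x ∈ g i → y ∈ g j → z ∈ g k → tri x y z ∈ g (i + j + k)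
  bs1 : ∀ i j x y, x ∈ g i → y ∈ g j → mul x y = -(sgn K i j • mul y x)
  bs2 : ∀ i j k x y z, x ∈ g i → y ∈ g j → z ∈ g k → tri x y z = -(sgn K i j • tri y x z)
  bs3 : ∀ i j k x y z, x ∈ g i → y ∈ g j → z ∈ g k →
    tri x y z + sgn K i (j + k) • tri y z x + sgn K k (i + j) • tri z x y = 0
  bs4 : ∀ i j k l m x y u v w, x ∈ g i → y ∈ g j → u ∈ g k → v ∈ g l → w ∈ g m →
    tri x y (tri u v w) = tri (tri x y u) v w + sgn K k (i + j) • tri u (tri x y v) w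
      + sgn K (i + j) (k + l) • tri u v (tri x y w)
  bs5 : ∀ i j k l x y u v, x ∈ g i → y ∈ g j → u ∈ g k → v ∈ g l →
    tri x y (mul u v) = sgn K k (i + j) • mul u (tri x y v) + mul (tri x y u) v
      + sgn K (i + j) (k + l) • tri u v (mul x y) + mul (mul x y) (mul u v)

variable {K B L : Type*} [Field K] [AddCommGroup B] [Module K B]

/-- `P` is a pseudo superderivation of degree `r` of the Bol superalgebra `A`
with companion `a ∈ A.g r`. -/
def IsPSD (A : BolSuper K B) (r : ZMod 2) (P : B →ₗ[K] B) (a : B) : Prop :=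
  a ∈ A.g r ∧
  (∀ i x, x ∈ A.g i → P x ∈ A.g (i + r)) ∧
  (∀ i j k x y z, x ∈ A.g i → y ∈ A.g j → z ∈ A.g k →
    P (A.tri x y z) = A.tri (P x) y z + sgn K r i • A.tri x (P y) z
      + sgn K r (i + j) • A.tri x y (P z)) ∧
  (∀ i j x y, x ∈ A.g i → y ∈ A.g j →
    P (A.mul x y) = sgn K r i • A.mul x (P y) + A.mul (P x) y
      + sgn K r (i + j) • A.tri x y a + A.mul a (A.mul x y))

/-- The bracket on pairs (pseudo superderivation, companion), for degrees `r`, `s`. -/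
def pbrk (A : BolSuper K B) (r s : ZMod 2)
    (pa qb : (B →ₗ[K] B) × B) : (B →ₗ[K] B) × B :=
  (pa.1 ∘ₗ qb.1 - sgn K r s • (qb.1 ∘ₗ pa.1),
   pa.1 qb.2 - sgn K r s • qb.1 pa.2 - A.mul pa.2 qb.2)

/-- The bracket on `B ⊕ H` (elements encoded as pairs `(x, (P, a))`),
for degrees `r`, `s`. -/
def lbrk (A : BolSuper K B) (r s : ZMod 2)
    (u v : B × ((B →ₗ[K] B) × B)) : B × ((B →ₗ[K] B) × B) :=
  (u.2.1 v.1 - sgn K r s • v.2.1 u.1,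
   (A.tri u.1 v.1 + (pbrk A r s u.2 v.2).1,
    A.mul u.1 v.1 + (pbrk A r s u.2 v.2).2))

/-- The degree-`r` part of the span of the inner pairs `(D_{x,u}, x·u)` with
`x` homogeneous in `B` and `u` homogeneous in the graded subspace `S`. -/
def IPSpan (A : BolSuper K B) (S : ZMod 2 → Submodule K B) (r : ZMod 2) :
    Submodule K ((B →ₗ[K] B) × B) :=
  Submodule.span K {pa | ∃ i j x u, i + j = r ∧ x ∈ A.g i ∧ u ∈ S j ∧
    pa = (A.tri x u, A.mul x u)}

/-- Data presenting a Lie superalgebra `L` as the standard enveloping Lie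
superalgebra `L(B) = B ⊕ IPS(B,B)` of the Bol superalgebra `A`, together with
the grading involution `sigma` used to define supertraces. -/
structure EnvSetup (K B L : Type*) [Field K] [AddCommGroup B] [Module K B]
    [AddCommGroup L] [Module K L] (A : BolSuper K B) where
  brk : L →ₗ[K] L →ₗ[K] L
  iota : B →ₗ[K] L
  jmap : ((B →ₗ[K] B) × B) →ₗ[K] L
  gL : ZMod 2 → Submodule K L
  gL_eq : ∀ r, gL r = (A.g r).map iota ⊔ (IPSpan A A.g r).map jmap
  surj : ∀ v : L, ∃ x pa, pa ∈ IPSpan A A.g 0 ⊔ IPSpan A A.g 1 ∧ v = iota x + jmap pa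
  inj : ∀ x pa, pa ∈ IPSpan A A.g 0 ⊔ IPSpan A A.g 1 → iota x + jmap pa = 0 →
    x = 0 ∧ pa = 0
  brk_bb : ∀ x y : B, brk (iota x) (iota y) = jmap (A.tri x y, A.mul x y)
  brk_pb : ∀ r pa, pa ∈ IPSpan A A.g r → ∀ x : B, brk (jmap pa) (iota x) = iota (pa.1 x)
  brk_bp : ∀ r s x pa, x ∈ A.g r → pa ∈ IPSpan A A.g s →
    brk (iota x) (jmap pa) = -(sgn K r s • iota (pa.1 x))
  brk_pp : ∀ r s pa qb, pa ∈ IPSpan A A.g r → qb ∈ IPSpan A A.g s →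
    brk (jmap pa) (jmap qb) = jmap (pbrk A r s pa qb)
  sigma : L →ₗ[K] L
  sigma0 : ∀ v ∈ gL 0, sigma v = v
  sigma1 : ∀ v ∈ gL 1, sigma v = -v

variable [AddCommGroup L] [Module K L]

/-- The Killing form `α(u,v) = str(ad u ∘ ad v)` of the enveloping Lie
superalgebra, the supertrace being computed via the grading involution. -/
noncomputable def killing {A : BolSuper K B} (E : EnvSetup K B L A) (u v : L) : K :=
  LinearMap.trace K L (E.sigma ∘ₗ E.brk u ∘ₗ E.brk v)

/-- The Killing-Ricci form of `B`: the restriction of the Killing form of the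
standard enveloping Lie superalgebra to `B × B`. -/
noncomputable def kr {A : BolSuper K B} (E : EnvSetup K B L A) (x y : B) : K :=
  killing E (E.iota x) (E.iota y)

theorem sgn_comm (K : Type*) [Field K] (i j : ZMod 2) : sgn K i j = sgn K j i := by
  simp only [sgn, mul_comm]

theorem sgn_add_right (K : Type*) [Field K] (i j k : ZMod 2) :
    sgn K i (j + k) = sgn K i j * sgn K i k := by
  have h : (i * (j + k)).val % 2 = ((i * j).val + (i * k).val) % 2 := by
    revert i j k; decide
  rw [sgn, sgn, sgn, ← pow_add, neg_one_pow_eq_pow_mod_two, h, ← neg_one_pow_eq_pow_mod_two]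

theorem sgn_add_left (K : Type*) [Field K] (i j k : ZMod 2) :
    sgn K (i + j) k = sgn K i k * sgn K j k := by
  rw [sgn_comm, sgn_add_right, sgn_comm K k i, sgn_comm K k j]

theorem sgn_eq_or (K : Type*) [Field K] (i j : ZMod 2) : sgn K i j = 1 ∨ sgn K i j = -1 :=
  neg_one_pow_eq_or K _

/-- the supercommutator `[P,R] = P∘R - (-1)^{rs} R∘P` of pseudo
superderivations of degrees `r` and `s` with companions `a` and `c` is a pseudo
superderivation of degree `r+s` with companion `P(c) - (-1)^{rs} R(a) - a·c`. -/
theorem stmt1 {K B : Type*} [Field K] [CharZero K] [AddCommGroup B] [Module K B]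
    (A : BolSuper K B) (r s : ZMod 2) (P R : B →ₗ[K] B) (a c : B)
    (hP : IsPSD A r P a) (hR : IsPSD A s R c) :
    IsPSD A (r + s) (P ∘ₗ R - sgn K r s • (R ∘ₗ P))
      (P c - sgn K r s • R a - A.mul a c) := by
  obtain ⟨ha, hPg, hPt, hPm⟩ := hP
  obtain ⟨hc, hRg, hRt, hRm⟩ := hR
  refine ⟨?_, ?_, ?_, ?_⟩
  · have h₁ := hPg _ _ hc
    have h₂ := hRg _ _ ha
    rw [add_comm] at h₁
    exact sub_mem (sub_mem h₁ (Submodule.smul_mem _ _ h₂)) (A.mul_mem _ _ _ _ ha hc)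
  · intro i x hx
    have h₁ := hPg _ _ (hRg _ _ hx)
    have h₂ := hRg _ _ (hPg _ _ hx)
    rw [add_assoc, add_comm s r] at h₁
    rw [add_assoc] at h₂
    exact sub_mem h₁ (Submodule.smul_mem _ _ h₂)
  · intro i j k x y z hx hy hz
    simp only [LinearMap.sub_apply, LinearMap.smul_apply, LinearMap.comp_apply, map_sub, map_smul,
      map_add, hRt i j k x y z hx hy hz, hPt i j k x y z hx hy hz,
      hPt _ _ _ _ _ _ (hRg _ _ hx) hy hz, hPt _ _ _ _ _ _ hx (hRg _ _ hy) hz,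
      hPt _ _ _ _ _ _ hx hy (hRg _ _ hz), hRt _ _ _ _ _ _ (hPg _ _ hx) hy hz,
      hRt _ _ _ _ _ _ hx (hPg _ _ hy) hz, hRt _ _ _ _ _ _ hx hy (hPg _ _ hz),
      sgn_add_left, sgn_add_right, sgn_comm K s r]
    rcases sgn_eq_or K r s with h | h <;> rw [h] <;> module
  · intro i j x y hx hy
    have hxy := A.mul_mem _ _ _ _ hx hy
    have h₁ := A.bs5 _ _ _ _ _ _ _ _ hx hy ha hc
    have h₂ := A.bs1 _ _ _ _ (A.tri_mem _ _ _ _ _ _ hx hy ha) hc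
    have h₃ := A.bs1 _ _ _ _ hxy (A.mul_mem _ _ _ _ ha hc)
    have h₄ := A.bs3 _ _ _ _ _ _ ha hc hxy
    have h₅ := A.bs2 _ _ _ _ _ _ ha hxy hc
    simp only [sgn_add_left, sgn_add_right, sgn_comm K i r, sgn_comm K j r,
      sgn_comm K i s, sgn_comm K j s] at h₁ h₂ h₃ h₄ h₅
    simp only [LinearMap.sub_apply, LinearMap.smul_apply, LinearMap.comp_apply, map_sub, map_smul,
      map_add, hRm i j x y hx hy, hPm i j x y hx hy,
      hPm _ _ _ _ (hRg _ _ hx) hy, hPm _ _ _ _ hx (hRg _ _ hy),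
      hPt _ _ _ _ _ _ hx hy hc, hPm _ _ _ _ hc hxy,
      hRm _ _ _ _ (hPg _ _ hx) hy, hRm _ _ _ _ hx (hPg _ _ hy),
      hRt _ _ _ _ _ _ hx hy ha, hRm _ _ _ _ ha hxy,
      sgn_add_left, sgn_add_right, sgn_comm K s r]
    rw [h₁, h₂, h₃, h₅]
    have q (k l : ZMod 2) : sgn K k l * sgn K k l = 1 := by
      rcases sgn_eq_or K k l with h | h <;> simp [h]
    have q₁ := q r s
    have q₂ := q r i
    have q₃ := q r j
    have q₄ := q s i
    have q₅ := q s j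
    linear_combination (norm := (match_scalars <;> grind only)) h₄
end

section
/- Let B be a finite-dimensional Bol superalgebra over a field K of characteristic 0, and let β be its Killing-Ricci form, i.e. the restriction to B × B of the Killing form of the standard enveloping Lie superalgebra L(B) = B ⊕ IPS(B,B). For homogeneous x,y ∈ B define R_{x,y} : B → B by R_{x,y}(z) := (−1)^{|z|(|x|+|y|)}[z,x,y] on homogeneous z. Then for all homogeneous x,y ∈ B: β(x,y) = str(R_{x,y} + (−1)^{|x||y|} R_{y,x}). -/
open LinearMap

variable {K B L : Type*} [Field K] [AddCommGroup B] [Module K B]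

variable [AddCommGroup L] [Module K L]

theorem sgn_zero_left (K : Type*) [Field K] (j : ZMod 2) : sgn K 0 j = 1 := by
  simp [sgn]

theorem sgn_zero_right (K : Type*) [Field K] (i : ZMod 2) : sgn K i 0 = 1 := by
  simp [sgn]

theorem sgn_one_one (K : Type*) [Field K] : sgn K 1 1 = -1 := by
  simp [sgn, ZMod.val_one]

theorem zmod_two_eq_zero_or_one : ∀ i : ZMod 2, i = 0 ∨ i = 1 := by
  decide

namespace BolSuper

/-- Linear maps out of a Bol superalgebra are determined by homogeneous elements. -/
theorem hom_ext {V : Type*} [AddCommGroup V] [Module K V] (A : BolSuper K B)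
    {f h : B →ₗ[K] V} (H : ∀ k z, z ∈ A.g k → f z = h z) : f = h := by
  ext v
  have hv : v ∈ ⨆ k, A.g k := by
    rw [A.internal.submodule_iSup_eq_top]
    trivial
  induction hv using Submodule.iSup_induction' with
  | mem k z hz => exact H k z hz
  | zero => simp
  | add a b _ _ ha hb => simp [ha, hb]

section Involution

variable {A : BolSuper K B} {s : B →ₗ[K] B}

theorem involution_apply (h0 : ∀ v ∈ A.g 0, s v = v) (h1 : ∀ v ∈ A.g 1, s v = -v)
    {k : ZMod 2} {z : B} (hz : z ∈ A.g k) : s z = sgn K 1 k • z := by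
  rcases zmod_two_eq_zero_or_one k with rfl | rfl
  · rw [h0 z hz, sgn_zero_right, one_smul]
  · rw [h1 z hz, sgn_one_one, neg_smul, one_smul]

theorem involution_pow_apply (h0 : ∀ v ∈ A.g 0, s v = v) (h1 : ∀ v ∈ A.g 1, s v = -v)
    {k : ZMod 2} {z : B} (hz : z ∈ A.g k) (r : ZMod 2) :
    (s ^ r.val) z = sgn K k r • z := by
  rcases zmod_two_eq_zero_or_one r with rfl | rfl
  · simp [sgn_zero_right]
  · rw [ZMod.val_one, pow_one, involution_apply h0 h1 hz]
    simp [sgn, mul_comm]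

/-- An odd endomorphism has trace zero. -/
theorem trace_eq_zero_of_odd [CharZero K] (h0 : ∀ v ∈ A.g 0, s v = v)
    (h1 : ∀ v ∈ A.g 1, s v = -v) {T : B →ₗ[K] B}
    (hT : ∀ k z, z ∈ A.g k → T z ∈ A.g (k + 1)) : LinearMap.trace K B T = 0 := by
  have hss : s * s = 1 := A.hom_ext fun k z hz => by
    rcases zmod_two_eq_zero_or_one k with rfl | rfl
    · simp [h0 z hz]
    · simp [h1 z hz]
  have hanti : s * T = -(T * s) := A.hom_ext fun k z hz => by
    have h := hT k z hz
    rcases zmod_two_eq_zero_or_one k with rfl | rfl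
    · simp [h0 z hz, h1 _ (by simpa using h)]
    · simp [h1 z hz, h0 _ h]
  have h : LinearMap.trace K B T = -LinearMap.trace K B T := by
    calc LinearMap.trace K B T = LinearMap.trace K B (s * (s * T)) := by
          rw [← mul_assoc, hss, one_mul]
      _ = -LinearMap.trace K B (s * (T * s)) := by rw [hanti, mul_neg, map_neg]
      _ = -LinearMap.trace K B T := by
          rw [LinearMap.trace_mul_comm, mul_assoc, hss, mul_one]
  exact self_eq_neg.mp h

end Involution

theorem inner_mem_IPSpan (A : BolSuper K B) {i j : ZMod 2} {x y : B} (hx : x ∈ A.g i)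
    (hy : y ∈ A.g j) : (A.tri x y, A.mul x y) ∈ IPSpan A A.g (i + j) :=
  Submodule.subset_span ⟨i, j, x, y, rfl, hx, hy, rfl⟩

theorem IPSpan_le (A : BolSuper K B) (r : ZMod 2) :
    IPSpan A A.g r ≤ IPSpan A A.g 0 ⊔ IPSpan A A.g 1 := by
  rcases zmod_two_eq_zero_or_one r with rfl | rfl
  exacts [le_sup_left, le_sup_right]

end BolSuper

namespace EnvSetup

variable {A : BolSuper K B} (E : EnvSetup K B L A)

theorem sigma_apply {r : ZMod 2} {v : L} (hv : v ∈ E.gL r) :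
    E.sigma v = sgn K 1 r • v := by
  rcases zmod_two_eq_zero_or_one r with rfl | rfl
  · rw [E.sigma0 v hv, sgn_zero_right, one_smul]
  · rw [E.sigma1 v hv, sgn_one_one, neg_smul, one_smul]

theorem sigma_iota {r : ZMod 2} {x : B} (hx : x ∈ A.g r) :
    E.sigma (E.iota x) = sgn K 1 r • E.iota x :=
  E.sigma_apply (by rw [E.gL_eq]; exact Submodule.mem_sup_left ⟨x, hx, rfl⟩)

theorem sigma_jmap {r : ZMod 2} {pa : (B →ₗ[K] B) × B} (h : pa ∈ IPSpan A A.g r) :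
    E.sigma (E.jmap pa) = sgn K 1 r • E.jmap pa :=
  E.sigma_apply (by rw [E.gL_eq]; exact Submodule.mem_sup_right ⟨pa, h, rfl⟩)

/-- The projection of the enveloping algebra onto `B` along the inner pairs. -/
theorem exists_projection : ∃ π : L →ₗ[K] B, (∀ x, π (E.iota x) = x) ∧
    ∀ pa ∈ IPSpan A A.g 0 ⊔ IPSpan A A.g 1, π (E.jmap pa) = 0 := by
  let S := IPSpan A A.g 0 ⊔ IPSpan A A.g 1
  let f : (B × S) →ₗ[K] L := E.iota.coprod (E.jmap ∘ₗ S.subtype)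
  have hf : Function.Bijective f := by
    constructor
    · refine (injective_iff_map_eq_zero f).mpr ?_
      rintro ⟨x, pa, hpa⟩ h
      obtain ⟨h1, h2⟩ := E.inj x pa hpa (by simpa [f] using h)
      simp [h1, h2]
    · intro v
      obtain ⟨x, pa, hpa, rfl⟩ := E.surj v
      exact ⟨(x, ⟨pa, hpa⟩), by simp [f]⟩
  let e := LinearEquiv.ofBijective f hf
  refine ⟨LinearMap.fst K B S ∘ₗ e.symm.toLinearMap, fun x => ?_, fun pa hpa => ?_⟩
  · have h : e.symm (E.iota x) = (x, 0) := by
      rw [LinearEquiv.symm_apply_eq]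
      simp [e, f]
    simp [h]
  · have h : e.symm (E.jmap pa) = (0, ⟨pa, hpa⟩) := by
      rw [LinearEquiv.symm_apply_eq]
      simp [e, f]
    simp [h]

/-- The adjoint action of a homogeneous element of `B` exchanges `B` and the inner pairs. -/
theorem brk_iota_eq {π : L →ₗ[K] B} (hι : ∀ x, π (E.iota x) = x)
    (hj : ∀ pa ∈ IPSpan A A.g 0 ⊔ IPSpan A A.g 1, π (E.jmap pa) = 0)
    {j : ZMod 2} {y : B} (hy : y ∈ A.g j) :
    E.brk (E.iota y) = E.brk (E.iota y) ∘ₗ E.iota ∘ₗ π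
      + E.iota ∘ₗ π ∘ₗ E.brk (E.iota y) := by
  have hB : π ∘ₗ E.brk (E.iota y) ∘ₗ E.iota = 0 := A.hom_ext fun k z hz => by
    simpa [E.brk_bb] using hj _ (A.IPSpan_le _ (A.inner_mem_IPSpan hy hz))
  have hP : ∀ r, ∀ pa ∈ IPSpan A A.g r, E.iota (π (E.brk (E.iota y) (E.jmap pa)))
      = E.brk (E.iota y) (E.jmap pa) := fun r pa hpa => by
    rw [E.brk_bp j r y pa hy hpa]
    simp [hι]
  ext v
  obtain ⟨x, pa, hpa, rfl⟩ := E.surj v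
  have hx : π (E.brk (E.iota y) (E.iota x)) = 0 := LinearMap.congr_fun hB x
  have hpa' : E.iota (π (E.brk (E.iota y) (E.jmap pa)))
      = E.brk (E.iota y) (E.jmap pa) := by
    obtain ⟨p, hp, q, hq, rfl⟩ := Submodule.mem_sup.mp hpa
    simp only [map_add, hP 0 p hp, hP 1 q hq]
  simp [hι, hj pa hpa, hx, hpa']

/-- The trace of an endomorphism preserving `B`, composed with the projection onto `B`. -/
theorem trace_comp_projection [FiniteDimensional K B] [FiniteDimensional K L]
    {π : L →ₗ[K] B} (hι : ∀ x, π (E.iota x) = x) {T : L →ₗ[K] L} {T' : B →ₗ[K] B}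
    (h : T ∘ₗ E.iota = E.iota ∘ₗ T') :
    LinearMap.trace K L (T ∘ₗ E.iota ∘ₗ π) = LinearMap.trace K B T' := by
  rw [← LinearMap.comp_assoc, h, LinearMap.trace_comp_comm', ← LinearMap.comp_assoc]
  congr 1
  ext x
  simp [hι]

theorem sigma_brk_brk_iota {s : B →ₗ[K] B} (h0 : ∀ v ∈ A.g 0, s v = v)
    (h1 : ∀ v ∈ A.g 1, s v = -v) {i j : ZMod 2} {x y : B} (hx : x ∈ A.g i)
    (hy : y ∈ A.g j) :
    (E.sigma ∘ₗ E.brk (E.iota x) ∘ₗ E.brk (E.iota y)) ∘ₗ E.iota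
      = E.iota ∘ₗ (sgn K i j • (s ∘ₗ (A.tri.flip y).flip x ∘ₗ s ^ (i + j).val)) :=
  A.hom_ext fun k z hz => by
    have hm := A.tri_mem k j i z y x hz hy hx
    simp only [LinearMap.comp_apply, E.brk_bb, LinearMap.smul_apply, LinearMap.flip_apply,
      E.brk_bp i (j + k) x _ hx (A.inner_mem_IPSpan hy hz), A.bs2 j k i y z x hy hz hx,
      BolSuper.involution_pow_apply h0 h1 hz, map_neg, map_smul,
      BolSuper.involution_apply h0 h1 hm, E.sigma_iota hm, neg_neg, smul_neg, smul_smul]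
    congr 1
    rcases zmod_two_eq_zero_or_one i with rfl | rfl <;>
    rcases zmod_two_eq_zero_or_one j with rfl | rfl <;>
    rcases zmod_two_eq_zero_or_one k with rfl | rfl <;>
    simp [sgn_zero_left, sgn_zero_right, sgn_one_one, CharTwo.add_self_eq_zero]

theorem brk_sigma_brk_iota {s : B →ₗ[K] B} (h0 : ∀ v ∈ A.g 0, s v = v)
    (h1 : ∀ v ∈ A.g 1, s v = -v) {i j : ZMod 2} {x y : B} (hx : x ∈ A.g i)
    (hy : y ∈ A.g j) :
    (E.brk (E.iota y) ∘ₗ E.sigma ∘ₗ E.brk (E.iota x)) ∘ₗ E.iota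
      = E.iota ∘ₗ ((sgn K i j * sgn K j 1) •
        (s ∘ₗ (A.tri.flip x).flip y ∘ₗ s ^ (i + j).val)) :=
  A.hom_ext fun k z hz => by
    have hm := A.tri_mem k i j z x y hz hx hy
    have hp := A.inner_mem_IPSpan hx hz
    simp only [LinearMap.comp_apply, E.brk_bb, LinearMap.smul_apply, LinearMap.flip_apply,
      E.sigma_jmap hp, E.brk_bp j (i + k) y _ hy hp, A.bs2 i k j x z y hx hz hy,
      BolSuper.involution_pow_apply h0 h1 hz, map_neg, map_smul,
      BolSuper.involution_apply h0 h1 hm, neg_neg, smul_neg, smul_smul]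
    congr 1
    rcases zmod_two_eq_zero_or_one i with rfl | rfl <;>
    rcases zmod_two_eq_zero_or_one j with rfl | rfl <;>
    rcases zmod_two_eq_zero_or_one k with rfl | rfl <;>
    simp [sgn_zero_left, sgn_zero_right, sgn_one_one, CharTwo.add_self_eq_zero]

end EnvSetup

/-- The supertrace of `R_{x,y}` absorbs the sign `(-1)^(|x||y| + |y|)`, since it vanishes when
`x` and `y` have different parities. -/
theorem sgn_mul_supertrace_tri [CharZero K] {A : BolSuper K B} {s : B →ₗ[K] B}
    (h0 : ∀ v ∈ A.g 0, s v = v) (h1 : ∀ v ∈ A.g 1, s v = -v) {i j : ZMod 2} {x y : B}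
    (hx : x ∈ A.g i) (hy : y ∈ A.g j) :
    (sgn K i j * sgn K j 1) *
      LinearMap.trace K B (s ∘ₗ (A.tri.flip x).flip y ∘ₗ s ^ (i + j).val)
      = LinearMap.trace K B (s ∘ₗ (A.tri.flip x).flip y ∘ₗ s ^ (i + j).val) := by
  by_cases hij : i = j
  · subst hij
    rcases zmod_two_eq_zero_or_one i with rfl | rfl <;>
    simp [sgn_zero_left, sgn_one_one]
  · have hij' : i + j = 1 :=
      (by decide : ∀ a b : ZMod 2, a ≠ b → a + b = 1) i j hij
    rw [BolSuper.trace_eq_zero_of_odd h0 h1, mul_zero]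
    intro k z hz
    have hm := A.tri_mem k i j z x y hz hx hy
    simp only [LinearMap.comp_apply, LinearMap.flip_apply, map_smul,
      BolSuper.involution_pow_apply h0 h1 hz, BolSuper.involution_apply h0 h1 hm]
    rw [add_assoc, hij'] at hm
    exact Submodule.smul_mem _ _ (Submodule.smul_mem _ _ hm)

/-- the Killing-Ricci form of a finite-dimensional Bol
superalgebra satisfies `β(x,y) = str(R_{x,y} + (-1)^{|x||y|} R_{y,x})` on
homogeneous elements, where `R_{x,y}(z) = (-1)^{|z|(|x|+|y|)}[z,x,y]` (here
realized as `z ↦ [·,x,y]` precomposed with the `(|x|+|y|)`-th power of the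
grading involution of `B`). -/
theorem stmt6 {K B L : Type*} [Field K] [CharZero K]
    [AddCommGroup B] [Module K B] [FiniteDimensional K B]
    [AddCommGroup L] [Module K L] [FiniteDimensional K L]
    (A : BolSuper K B) (E : EnvSetup K B L A)
    (sigB : B →ₗ[K] B)
    (hsigB0 : ∀ v ∈ A.g 0, sigB v = v) (hsigB1 : ∀ v ∈ A.g 1, sigB v = -v) :
    ∀ (i j : ZMod 2) (x y : B), x ∈ A.g i → y ∈ A.g j →
      kr E x y = LinearMap.trace K B (sigB ∘ₗ
        (((A.tri.flip x).flip y ∘ₗ sigB ^ (i + j).val)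
          + sgn K i j • ((A.tri.flip y).flip x ∘ₗ sigB ^ (i + j).val))) := by
  intro i j x y hx hy
  obtain ⟨π, hι, hj⟩ := E.exists_projection
  have hsplit : E.sigma ∘ₗ E.brk (E.iota x) ∘ₗ E.brk (E.iota y)
      = (E.sigma ∘ₗ E.brk (E.iota x) ∘ₗ E.brk (E.iota y)) ∘ₗ E.iota ∘ₗ π
        + (E.sigma ∘ₗ E.brk (E.iota x) ∘ₗ E.iota ∘ₗ π) ∘ₗ E.brk (E.iota y) := by
    conv_lhs => rw [E.brk_iota_eq hι hj hy]
    simp only [LinearMap.comp_add, LinearMap.comp_assoc]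
  have hcomm : E.brk (E.iota y) ∘ₗ E.sigma ∘ₗ E.brk (E.iota x) ∘ₗ E.iota ∘ₗ π
      = (E.brk (E.iota y) ∘ₗ E.sigma ∘ₗ E.brk (E.iota x)) ∘ₗ E.iota ∘ₗ π := by
    simp only [LinearMap.comp_assoc]
  rw [kr, killing, hsplit, map_add, LinearMap.trace_comp_comm' (E.brk (E.iota y)), hcomm,
    E.trace_comp_projection hι (E.sigma_brk_brk_iota hsigB0 hsigB1 hx hy),
    E.trace_comp_projection hι (E.brk_sigma_brk_iota hsigB0 hsigB1 hx hy),
    map_smul, map_smul, smul_eq_mul (sgn K i j * sgn K j 1),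
    sgn_mul_supertrace_tri hsigB0 hsigB1 hx hy, LinearMap.comp_add, LinearMap.comp_smul,
    map_add, map_smul, add_comm]
end
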